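/- Let U and V be ultrafilters on ω. If U^{<ω} is a P⁺-filter and (V,⊇) is Tukey reducible to (U,⊇), then V^{<ω} is a P⁺-filter. (Equivalently: if U is Canjar and U ≥_T V, then V is Canjar.) -/

import Mathlib

open Set Filter

/-- `D` is cofinal in the quasi-order `r`: every point is `r`-below some element of `D`. -/
def CofinalIn {α : Type*} (r : α → α → Prop) (D : Set α) : Prop :=
  ∀ p : α, ∃ d ∈ D, r p d

/-- `(β, rQ)` is Tukey reducible to `(α, rP)`: there is a map `α → β`
sending every cofinal subset of `(α, rP)` to a cofinal subset of `(β, rQ)`. -/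
def TukeyLE {β α : Type*} (rQ : β → β → Prop) (rP : α → α → Prop) : Prop :=
  ∃ f : α → β, ∀ D : Set α, CofinalIn rP D → CofinalIn rQ (f '' D)

/-- The quasi-order `(U, ⊇)` on the members of an ultrafilter `U`. -/
def UFOrder (U : Ultrafilter ℕ) : {A : Set ℕ // A ∈ U} → {A : Set ℕ // A ∈ U} → Prop :=
  fun A B => B.1 ⊆ A.1

/-- Everywhere domination order on `ω^ω`. -/
def domLE (f g : ℕ → ℕ) : Prop := ∀ n, f n ≤ g n

/-- Eventual domination order `≤*` on `ω^ω`. -/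
def evDomLE (f g : ℕ → ℕ) : Prop := ∀ᶠ n in atTop, f n ≤ g n

/-- `[A]^{<ω}`: the nonempty finite subsets of `A`. -/
def FinCube (A : Set ℕ) : Set (Finset ℕ) := {s | s.Nonempty ∧ ↑s ⊆ A}

/-- `X ⊆ FIN` is `U^{<ω}`-positive: it consists of nonempty finite sets and
meets `[A]^{<ω}` for every `A ∈ U`. -/
def UPositive (U : Ultrafilter ℕ) (X : Set (Finset ℕ)) : Prop :=
  (∀ s ∈ X, s.Nonempty) ∧ ∀ A ∈ U, (X ∩ FinCube A).Nonempty

/-- `U^{<ω}` is a P⁺-filter: every ⊆-decreasing sequence of `U^{<ω}`-positive sets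
has a `U^{<ω}`-positive pseudo-intersection. -/
def PPlus (U : Ultrafilter ℕ) : Prop :=
  ∀ X : ℕ → Set (Finset ℕ),
    (∀ n, UPositive U (X n)) → (∀ n, X (n + 1) ⊆ X n) →
    ∃ Y : Set (Finset ℕ), UPositive U Y ∧ ∀ n, (Y \ X n).Finite

/-- A Tukey reduction between ultrafilters is witnessed by a monotone map with cofinal range. -/
theorem TukeyLE.exists_monotone {U V : Ultrafilter ℕ} (h : TukeyLE (UFOrder V) (UFOrder U)) :
    ∃ f : Set ℕ → Set ℕ, Monotone f ∧ (∀ A ∈ U, f A ∈ V) ∧ ∀ C ∈ V, ∃ A ∈ U, f A ⊆ C := by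
  obtain ⟨f, hf⟩ := h
  refine ⟨fun A => {j | ∃ B : {B : Set ℕ // B ∈ U}, B.1 ⊆ A ∧ j ∈ (f B).1}, ?_, ?_, ?_⟩
  · rintro A A' hA j ⟨B, hB, hj⟩
    exact ⟨B, hB.trans hA, hj⟩
  · intro A hA
    exact mem_of_superset (f ⟨A, hA⟩).2 fun j hj => ⟨⟨A, hA⟩, Subset.rfl, hj⟩
  · intro C hC
    by_contra! hcon
    obtain ⟨_, ⟨B, hB, rfl⟩, hBC⟩ := hf {B | ¬ (f B).1 ⊆ C} (by
      intro A
      obtain ⟨j, ⟨B, hBA, hj⟩, hjC⟩ := not_subset.1 (hcon A.1 A.2)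
      exact ⟨B, fun h => hjC (h hj), hBA⟩) ⟨C, hC⟩
    exact hB hBC

theorem UPositive.finCube {U : Ultrafilter ℕ} {A : Set ℕ} (hA : A ∈ U) :
    UPositive U (FinCube A) := by
  refine ⟨fun s hs => hs.1, fun B hB => ?_⟩
  obtain ⟨x, hxA, hxB⟩ := U.nonempty_of_mem (inter_mem hA hB)
  exact ⟨{x}, ⟨by simp, by simpa using hxA⟩, by simp, by simpa using hxB⟩

/-- If `U^{<ω}` is a P⁺-filter then `U` is a P-point. -/
theorem PPlus.exists_pseudoInter {U : Ultrafilter ℕ} (hU : PPlus U) {B : ℕ → Set ℕ}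
    (hB : ∀ n, B n ∈ U) (hanti : Antitone B) : ∃ A ∈ U, ∀ n, (A \ B n).Finite := by
  obtain ⟨Y, hY, hfin⟩ := hU (fun n => FinCube (B n)) (fun n => .finCube (hB n))
    (fun n s hs => ⟨hs.1, hs.2.trans (hanti n.le_succ)⟩)
  refine ⟨⋃ s ∈ Y, (s : Set ℕ), ?_, fun n => ?_⟩
  · by_contra hcon
    obtain ⟨s, hs, ⟨x, hx⟩, hsub⟩ := hY.2 _ (Ultrafilter.compl_mem_iff_notMem.2 hcon)
    exact hsub hx (mem_biUnion hs hx)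
  · refine ((hfin n).biUnion fun s _ => s.finite_toSet).subset ?_
    rintro x ⟨hx, hxB⟩
    obtain ⟨s, hs, hxs⟩ := mem_iUnion₂.1 hx
    exact mem_biUnion ⟨hs, fun h => hxB (h.2 hxs)⟩ hxs

/-- In a P-point, an antitone sequence admits a pseudo-intersection whose tails from `n` on are
included in the `n`-th set for unboundedly many `n`. -/
theorem PPlus.exists_tail_subset {U : Ultrafilter ℕ} (hU : PPlus U) {B : ℕ → Set ℕ}
    (hB : ∀ n, B n ∈ U) (hanti : Antitone B) :
    ∃ A ∈ U, ∀ m, ∃ n, m ≤ n ∧ ∀ x ∈ A, n ≤ x → x ∈ B n := by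
  obtain ⟨A, hA, hfin⟩ := hU.exists_pseudoInter hB hanti
  have hg : ∀ n, ∃ k, n < k ∧ ∀ x ∈ A, k ≤ x → x ∈ B n := by
    intro n
    obtain ⟨b, hb⟩ := (hfin n).bddAbove
    refine ⟨max n b + 1, by omega, fun x hx hkx => ?_⟩
    by_contra hxB
    have : x ≤ b := hb ⟨hx, hxB⟩
    omega
  choose g hlt hsub using hg
  let a : ℕ → ℕ := fun i => g^[i] 0
  have ha : ∀ i, a (i + 1) = g (a i) := fun i => Function.iterate_succ_apply' g i 0
  have hmono : StrictMono a := strictMono_nat_of_lt_succ fun i => by rw [ha]; exact hlt _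
  let E : Set ℕ := {x | ∃ i, a (2 * i) ≤ x ∧ x < a (2 * i + 1)}
  rcases U.mem_or_compl_mem E with hE | hE
  · refine ⟨A ∩ E, inter_mem hA hE, fun m => ⟨a (2 * m + 1), ?_, ?_⟩⟩
    · have := hmono.le_apply (x := 2 * m + 1)
      omega
    · rintro x ⟨hxA, i, hi, hi'⟩ hx
      have h1 : 2 * m + 1 < 2 * i + 1 := hmono.lt_iff_lt.1 (hx.trans_lt hi')
      refine hsub _ x hxA ?_
      rw [← ha]
      exact (hmono.monotone (by omega)).trans hi
  · refine ⟨A ∩ Eᶜ, inter_mem hA hE, fun m => ⟨a (2 * m), ?_, ?_⟩⟩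
    · have := hmono.le_apply (x := 2 * m)
      omega
    · rintro x ⟨hxA, hxE⟩ hx
      refine hsub _ x hxA ?_
      rw [← ha]
      by_contra! hcon
      exact hxE ⟨m, hx, hcon⟩

/-- The points that a finite set `t` forces into `f A`, for all `A ∈ U` containing `t`. -/
def forcedPart (U : Ultrafilter ℕ) (f : Set ℕ → Set ℕ) (t : Finset ℕ) : Set ℕ :=
  {j | ∀ A ∈ U, (t : Set ℕ) ⊆ A → j ∈ f A}

theorem forcedPart_mono (U : Ultrafilter ℕ) (f : Set ℕ → Set ℕ) : Monotone (forcedPart U f) :=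
  fun _ _ hst _ hj A hA hsub => hj A hA ((Finset.coe_subset.2 hst).trans hsub)

theorem forcedPart_subset {U : Ultrafilter ℕ} {f : Set ℕ → Set ℕ} {t : Finset ℕ} {A : Set ℕ}
    (hA : A ∈ U) (ht : (t : Set ℕ) ⊆ A) : forcedPart U f t ⊆ f A :=
  fun _ hj => hj A hA ht

/-- For a monotone map on a P-point, the part of the image which is determined by finite
subsets of `A` is large. -/
theorem PPlus.iUnion_forcedPart_mem {U V : Ultrafilter ℕ} (hU : PPlus U) {f : Set ℕ → Set ℕ}
    (hf : Monotone f) (hfV : ∀ A ∈ U, f A ∈ V) {A : Set ℕ} (hA : A ∈ U) :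
    {j | ∃ t : Finset ℕ, (t : Set ℕ) ⊆ A ∧ j ∈ forcedPart U f t} ∈ V := by
  by_contra hcon
  rw [← Ultrafilter.compl_mem_iff_notMem] at hcon
  set C := {j | ∃ t : Finset ℕ, (t : Set ℕ) ⊆ A ∧ j ∈ forcedPart U f t}ᶜ
  have hB : ∀ (j : ℕ) (t : Finset ℕ), ∃ B ∈ U,
      j ∈ C → (t : Set ℕ) ⊆ A → (t : Set ℕ) ⊆ B ∧ j ∉ f B := by
    intro j t
    by_cases hjt : j ∈ C ∧ (t : Set ℕ) ⊆ A
    · by_contra! hno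
      refine hjt.1 ⟨t, hjt.2, fun B hBU htB => (hno B hBU).2.2 htB⟩
    · exact ⟨univ, univ_mem, fun h1 h2 => absurd ⟨h1, h2⟩ hjt⟩
  choose B hBU hBf using hB
  let D : ℕ → Set ℕ := fun k =>
    ⋂ p ∈ Finset.range k ×ˢ (Finset.range k).powerset, B p.1 p.2
  have hD : ∀ k, D k ∈ U := fun k => (Filter.biInter_finset_mem _).2 fun p _ => hBU _ _
  have hanti : Antitone D := by
    intro k l hkl
    refine biInter_subset_biInter_left fun p hp => ?_
    have hr := Finset.range_mono hkl
    exact Finset.product_subset_product hr (Finset.powerset_mono.2 hr) hp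
  obtain ⟨E, hE, htail⟩ := hU.exists_tail_subset hD hanti
  obtain ⟨j, hjf, hjC⟩ := V.nonempty_of_mem (inter_mem (hfV _ (inter_mem hE hA)) hcon)
  obtain ⟨n, hjn, hn⟩ := htail (j + 1)
  classical
  let t : Finset ℕ := {x ∈ Finset.range n | x ∈ E ∩ A}
  have htA : (t : Set ℕ) ⊆ A := fun x hx => by
    simp only [t, Finset.coe_filter, mem_ofPred_eq] at hx
    exact hx.2.2
  obtain ⟨htB, hjB⟩ := hBf j t hjC htA
  refine hjB (hf ?_ hjf)
  intro x hx
  rcases lt_or_ge x n with hxn | hxn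
  · exact htB (by simp only [t, Finset.coe_filter, mem_ofPred_eq]; exact ⟨by simpa using hxn, hx⟩)
  · refine mem_iInter₂.1 (hn x hx.1 hxn) (j, t) ?_
    simp only [Finset.mem_product, Finset.mem_range, Finset.mem_powerset]
    exact ⟨by omega, Finset.filter_subset _ _⟩

/-- The intersection of a positive set with a positive set that almost contains it is positive. -/
theorem UPositive.inter_of_finite_diff {U : Ultrafilter ℕ} {X Y : Set (Finset ℕ)}
    (hY : UPositive U Y) (hX : UPositive U X) (hfin : (Y \ X).Finite) : UPositive U (Y ∩ X) := by
  refine ⟨fun s hs => hY.1 s hs.1, fun A hA => ?_⟩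
  by_cases hF : (⋃ s ∈ Y \ X, (s : Set ℕ)) ∈ U
  · obtain ⟨x, -, hx⟩ := Ultrafilter.eq_pure_of_finite_mem
      (hfin.biUnion fun s _ => s.finite_toSet) hF
    have hxU : {x} ∈ U := by rw [hx]; exact mem_pure.2 rfl
    have hxA : x ∈ A := by rw [hx] at hA; exact hA
    have key : ∀ Z, UPositive U Z → {x} ∈ Z := by
      intro Z hZ
      obtain ⟨s, hs, hne, hsx⟩ := hZ.2 _ hxU
      rwa [Finset.Nonempty.subset_singleton_iff hne |>.1 (by exact_mod_cast hsx)] at hs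
    exact ⟨{x}, ⟨key Y hY, key X hX⟩, by simp, by simpa using hxA⟩
  · obtain ⟨s, hs, hne, hsub⟩ := hY.2 _ (inter_mem hA (Ultrafilter.compl_mem_iff_notMem.2 hF))
    refine ⟨s, ⟨hs, ?_⟩, hne, hsub.trans inter_subset_left⟩
    by_contra hsX
    obtain ⟨x, hx⟩ := hne
    exact (hsub hx).2 (mem_biUnion ⟨hs, hsX⟩ hx)

/-- Theorem: if `U^{<ω}` is a P⁺-filter (i.e. `U` is Canjar) and
`(V, ⊇) ≤_T (U, ⊇)`, then `V^{<ω}` is a P⁺-filter (i.e. `V` is Canjar). -/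
theorem stmt_9 (U V : Ultrafilter ℕ) (hU : PPlus U)
    (hT : TukeyLE (UFOrder V) (UFOrder U)) : PPlus V := by
  obtain ⟨f, hf, hfV, hfcof⟩ := hT.exists_monotone
  intro X hX hXsucc
  have hXanti : Antitone X := antitone_nat_of_succ_le hXsucc
  let X' : ℕ → Set (Finset ℕ) := fun n =>
    {t | t.Nonempty ∧ ∃ s ∈ X n, (s : Set ℕ) ⊆ forcedPart U f t}
  have hX' : ∀ n, UPositive U (X' n) := by
    refine fun n => ⟨fun t ht => ht.1, fun A hA => ?_⟩
    obtain ⟨s, hs, -, hsub⟩ := (hX n).2 _ (hU.iUnion_forcedPart_mem hf hfV hA)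
    choose! τ hτA hτ using hsub
    obtain ⟨a, ha⟩ := U.nonempty_of_mem hA
    have htA : ((insert a (s.biUnion τ) : Finset ℕ) : Set ℕ) ⊆ A := by
      intro x hx
      simp only [Finset.coe_insert, Finset.coe_biUnion, mem_insert_iff, mem_iUnion] at hx
      rcases hx with rfl | ⟨j, hj, hx⟩
      · exact ha
      · exact hτA hj hx
    refine ⟨insert a (s.biUnion τ), ⟨by simp, s, hs, fun j hj => ?_⟩, by simp, htA⟩
    exact forcedPart_mono U f
      ((Finset.subset_biUnion_of_mem τ hj).trans (Finset.subset_insert _ _)) (hτ hj)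
  obtain ⟨Y, hY, hfin⟩ := hU X' hX' fun n t ht =>
    ⟨ht.1, ht.2.imp fun s hs => ⟨hXsucc n hs.1, hs.2⟩⟩
  have hY' := hY.inter_of_finite_diff (hX' 0) (hfin 0)
  have hchoice : ∀ t ∈ Y ∩ X' 0, ∃ s : Finset ℕ, (s : Set ℕ) ⊆ forcedPart U f t ∧ s ∈ X 0 ∧
      ∀ n ≤ Encodable.encode t, t ∈ X' n → s ∈ X n := by
    intro t ht
    classical
    obtain ⟨-, s, hs, hsub⟩ := Nat.findGreatest_spec (P := fun n => t ∈ X' n)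
      (Nat.zero_le (Encodable.encode t)) ht.2
    exact ⟨s, hsub, hXanti (Nat.zero_le _) hs,
      fun n hn htn => hXanti (Nat.le_findGreatest hn htn) hs⟩
  choose! σ hσsub hσ0 hσ using hchoice
  refine ⟨σ '' (Y ∩ X' 0), ⟨?_, fun C hC => ?_⟩, fun n => ?_⟩
  · rintro _ ⟨t, ht, rfl⟩
    exact (hX 0).1 _ (hσ0 t ht)
  · obtain ⟨A, hA, hAC⟩ := hfcof C hC
    obtain ⟨t, ht, -, htA⟩ := hY'.2 A hA
    exact ⟨σ t, mem_image_of_mem σ ht, (hX 0).1 _ (hσ0 t ht),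
      (hσsub t ht).trans ((forcedPart_subset hA htA).trans hAC)⟩
  · have hcode : {t : Finset ℕ | Encodable.encode t < n}.Finite :=
      (finite_lt_nat n).preimage Encodable.encode_injective.injOn
    refine (((hfin n).union hcode).image σ).subset ?_
    rintro _ ⟨⟨t, ht, rfl⟩, hn⟩
    refine mem_image_of_mem σ ?_
    by_cases htn : t ∈ X' n
    · exact Or.inr (not_le.1 fun h => hn (hσ t ht n h htn))
    · exact Or.inl ⟨ht.1, htn⟩
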